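/- arXiv:math/0508351 — 2 statements merged into one kernel-verified Lean document; each statement's English description precedes it below -/
import Mathlib

section
/- The number of quandle structures on a set of 5 elements (equivalently, the number of 5 × 5 standard form quandle matrices) is 404: there are exactly 404 binary operations ▷ on {1,…,5} satisfying the three quandle axioms. -/
/-- A binary operation is a quandle operation if it satisfies the three quandle axioms. -/
def IsQuandleOp {Q : Type*} (op : Q → Q → Q) : Prop :=
  (∀ x, op x x = x) ∧
  (∀ x y, ∃! z, x = op z y) ∧
  (∀ x y z, op (op x y) z = op (op x z) (op y z))

/-- A five-element type whose case distinctions the kernel evaluates in one step. -/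
inductive Pt
  | a | b | c | d | e
  deriving DecidableEq

namespace Pt

instance : Fintype Pt := ⟨{a, b, c, d, e}, fun x => by cases x <;> decide⟩

/-- The function on `Pt` with the given five values. -/
noncomputable def elim {α : Sort*} (p q r s t : α) (x : Pt) : α := Pt.rec p q r s t x

/-- Boolean equality test. -/
noncomputable def beq (x y : Pt) : Bool :=
  x.elim (y.elim true false false false false) (y.elim false true false false false)
    (y.elim false false true false false) (y.elim false false false true false)
    (y.elim false false false false true)

/-- Boolean universal quantification over `Pt`. -/
def all (f : Pt → Bool) : Bool := f a && f b && f c && f d && f e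

/-- The list of all elements of `Pt`. -/
def list : List Pt := [a, b, c, d, e]

/-- The list of permutations of `Pt` that fix `k`. -/
noncomputable def perms (k : Pt) : List (Pt → Pt) :=
  (list.flatMap fun x₁ => list.flatMap fun x₂ => list.flatMap fun x₃ => list.flatMap fun x₄ =>
    list.map fun x₅ => elim x₁ x₂ x₃ x₄ x₅).filter
    fun f => (f k).beq k && all fun x => all fun y => x.beq y || !(f x).beq (f y)

/-- Test a Boolean condition on the value of an option, if there is one. -/
noncomputable def whenSome {α : Type*} (o : Option α) (f : α → Bool) : Bool := Option.rec true f o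

/-- A partial operation table gives the right translations `x ↦ x ▷ y` for some of the `y`.
It is consistent if self-distributivity holds wherever all translations involved are defined. -/
noncomputable def consistent (p : Pt → Option (Pt → Pt)) : Bool :=
  all fun z => whenSome (p z) fun f => all fun y => whenSome (p y) fun g =>
    whenSome (p (f y)) fun h => all fun x => (f (g x)).beq (h (f x))

/-- Set the right translation by `k` in a partial table. -/
noncomputable def update (p : Pt → Option (Pt → Pt)) (k : Pt) (f : Pt → Pt) (x : Pt) :
    Option (Pt → Pt) :=
  cond (x.beq k) (some f) (p x)

/-- Count the completions of a partial table to a quandle by backtracking over the undefined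
right translations. -/
noncomputable def search : List Pt → (Pt → Option (Pt → Pt)) → ℕ
  | [], _ => 1
  | k :: ks, p =>
    ((perms k).map fun f => cond (consistent (update p k f)) (search ks (update p k f)) 0).sum

theorem beq_iff {x y : Pt} : x.beq y = true ↔ x = y := by
  cases x <;> cases y <;> simp [beq, elim]

theorem all_iff {f : Pt → Bool} : all f = true ↔ ∀ x, f x = true := by
  constructor
  · intro h x
    simp only [all, Bool.and_eq_true] at h
    cases x <;> tauto
  · intro h
    simp [all, h]

theorem mem_list (x : Pt) : x ∈ list := by
  cases x <;> simp [list]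

theorem whenSome_iff {α : Type*} {o : Option α} {f : α → Bool} :
    whenSome o f = true ↔ ∀ x, o = some x → f x = true := by
  cases o <;> simp [whenSome]

theorem mem_perms {k : Pt} {f : Pt → Pt} :
    f ∈ perms k ↔ f k = k ∧ Function.Injective f := by
  have hf : elim (f a) (f b) (f c) (f d) (f e) = f := by
    funext x
    cases x <;> rfl
  have hmem : f ∈ list.flatMap fun x₁ => list.flatMap fun x₂ => list.flatMap fun x₃ =>
      list.flatMap fun x₄ => list.map fun x₅ => elim x₁ x₂ x₃ x₄ x₅ := by
    simp only [List.mem_flatMap, List.mem_map]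
    exact ⟨_, mem_list _, _, mem_list _, _, mem_list _, _, mem_list _, _, mem_list _, hf⟩
  rw [perms, List.mem_filter, and_iff_right hmem, Bool.and_eq_true, beq_iff, all_iff]
  refine and_congr_right fun _ => forall_congr' fun x => ?_
  rw [all_iff]
  refine forall_congr' fun y => ?_
  rw [Bool.or_eq_true, Bool.not_eq_true', ← Bool.not_eq_true, beq_iff, beq_iff]
  tauto

theorem nodup_perms (k : Pt) : (perms k).Nodup := by
  revert k
  decide +kernel

theorem consistent_iff {p : Pt → Option (Pt → Pt)} :
    consistent p = true ↔ ∀ y z f g h, p z = some f → p y = some g → p (f y) = some h →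
      ∀ x, f (g x) = h (f x) := by
  simp only [consistent, all_iff, whenSome_iff, beq_iff]
  exact ⟨fun H y z f g h hf hg hh x => H z f hf y g hg h hh x,
    fun H z f hf y g hg h hh x => H y z f g h hf hg hh x⟩

theorem update_self (p : Pt → Option (Pt → Pt)) (k : Pt) (f : Pt → Pt) :
    update p k f k = some f := by
  simp [update, beq_iff.2]

theorem update_of_ne (p : Pt → Option (Pt → Pt)) {k x : Pt} (f : Pt → Pt) (h : x ≠ k) :
    update p k f x = p x := by
  have : x.beq k = false := by rwa [← Bool.not_eq_true, beq_iff]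
  simp [update, this]

/-- A family `t` of right translations defines a quandle iff each `t k` is a permutation fixing
`k` and the resulting table is consistent. -/
theorem isQuandleOp_flip_iff {t : Pt → Pt → Pt} :
    IsQuandleOp (flip t) ↔ (∀ k, t k ∈ perms k) ∧ consistent (fun k => some (t k)) = true := by
  simp only [IsQuandleOp, flip, mem_perms, forall_and, and_assoc, consistent_iff,
    Option.some.injEq]
  refine and_congr_right fun _ => and_congr ?_ ?_
  · rw [forall_comm]
    refine forall_congr' fun y => ?_
    rw [Finite.injective_iff_bijective, Function.bijective_iff_existsUnique]
    simp only [eq_comm]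
  · constructor
    · rintro H y z _ _ _ rfl rfl rfl x
      exact H x y z
    · exact fun H x y z => H y z _ _ _ rfl rfl rfl x

/-- The quandle structures, as families of right translations, that extend a partial table. -/
noncomputable def completions (p : Pt → Option (Pt → Pt)) : Finset (Pt → Pt → Pt) :=
  (Set.toFinite {t | IsQuandleOp (flip t) ∧ ∀ k f, p k = some f → t k = f}).toFinset

theorem mem_completions {p : Pt → Option (Pt → Pt)} {t : Pt → Pt → Pt} :
    t ∈ completions p ↔ IsQuandleOp (flip t) ∧ ∀ k f, p k = some f → t k = f := by
  simp [completions]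

theorem consistent_of_mem_completions {p : Pt → Option (Pt → Pt)} {t : Pt → Pt → Pt}
    (ht : t ∈ completions p) : consistent p = true := by
  obtain ⟨hq, hp⟩ := mem_completions.1 ht
  rw [consistent_iff]
  intro y z f g h hf hg hh x
  rw [← hp _ _ hf] at hh ⊢
  rw [← hp _ _ hg, ← hp _ _ hh]
  exact hq.2.2 x y z

theorem mem_completions_update {p : Pt → Option (Pt → Pt)} {k : Pt} (hk : p k = none)
    {f : Pt → Pt} {t : Pt → Pt → Pt} :
    t ∈ completions (update p k f) ↔ t ∈ completions p ∧ t k = f := by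
  rw [mem_completions, mem_completions, and_assoc]
  refine and_congr_right fun _ => ⟨fun H => ⟨fun y g hg => ?_, H k f (update_self p k f)⟩, ?_⟩
  · refine H y g ?_
    rwa [update_of_ne]
    rintro rfl
    simp [hk] at hg
  · rintro ⟨H, rfl⟩ y g hg
    by_cases h : y = k
    · subst h
      simpa [update_self] using hg
    · rw [update_of_ne _ _ h] at hg
      exact H y g hg

theorem search_eq_card_completions (ks : List Pt) (p : Pt → Option (Pt → Pt)) (hks : ks.Nodup)
    (hnone : ∀ k, p k = none ↔ k ∈ ks) (hperm : ∀ k f, p k = some f → f ∈ perms k)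
    (hp : consistent p = true) : search ks p = (completions p).card := by
  classical
  induction ks generalizing p with
  | nil =>
    have hsome (k : Pt) : ∃ f, p k = some f := by
      rw [← Option.ne_none_iff_exists']
      simp [hnone]
    choose t ht using hsome
    obtain rfl : p = fun k => some (t k) := funext ht
    have : completions (fun k => some (t k)) = {t} := by
      ext s
      rw [mem_completions, Finset.mem_singleton]
      constructor
      · exact fun h => funext fun k => h.2 k _ rfl
      · rintro rfl
        exact ⟨isQuandleOp_flip_iff.2 ⟨fun k => hperm k _ rfl, hp⟩, by simp⟩
    rw [this, search, Finset.card_singleton]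
  | cons k ks ih =>
    obtain ⟨hk, hks⟩ := List.nodup_cons.1 hks
    have hpk : p k = none := (hnone k).2 (by simp)
    have hmaps : Set.MapsTo (fun t : Pt → Pt → Pt => t k) (completions p)
        (perms k).toFinset := fun t ht => by
      simpa using (isQuandleOp_flip_iff.1 (mem_completions.1 ht).1).1 k
    rw [search, Finset.card_eq_sum_card_fiberwise hmaps, List.sum_toFinset _ (nodup_perms k)]
    congr 1
    refine List.map_congr_left fun f hf => ?_
    have hfiber : (completions p).filter (fun t => t k = f) = completions (update p k f) := by
      ext t
      rw [Finset.mem_filter, mem_completions_update hpk]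
    rw [hfiber]
    cases hc : consistent (update p k f) with
    | false =>
      rw [cond_false, eq_comm, Finset.card_eq_zero, Finset.eq_empty_iff_forall_notMem]
      intro t ht
      simp [consistent_of_mem_completions ht] at hc
    | true =>
      refine ih _ hks (fun y => ?_) (fun y g hg => ?_) hc
      · by_cases h : y = k
        · subst h
          simp [update_self, hk]
        · simp [update_of_ne _ _ h, hnone, h]
      · by_cases h : y = k
        · subst h
          rw [update_self, Option.some.injEq] at hg
          exact hg ▸ hf
        · exact hperm y g (by rwa [update_of_ne _ _ h] at hg)

theorem search_list_none : search list (fun _ => none) = 404 := by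
  decide +kernel

theorem card_completions_none : (completions fun _ => none).card = 404 := by
  rw [← search_list_none, search_eq_card_completions]
  · decide
  · simp [mem_list]
  · simp
  · simp [consistent_iff]

end Pt

theorem IsQuandleOp.of_equiv {Q R : Type*} (φ : Q ≃ R) {op : Q → Q → Q} (h : IsQuandleOp op) :
    IsQuandleOp fun x y => φ (op (φ.symm x) (φ.symm y)) := by
  refine ⟨fun x => by simp [h.1], fun x y => ?_, fun x y z => by simp [← h.2.2]⟩
  obtain ⟨z, hz, huniq⟩ := h.2.1 (φ.symm x) (φ.symm y)
  refine ⟨φ z, by simp [← hz], fun w hw => ?_⟩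
  rw [← huniq (φ.symm w) (by simp [hw]), φ.apply_symm_apply]

/-- Transport of quandle structures along a bijection. -/
def quandleOpCongr {Q R : Type*} (φ : Q ≃ R) :
    {op : Q → Q → Q // IsQuandleOp op} ≃ {op : R → R → R // IsQuandleOp op} where
  toFun op := ⟨_, op.2.of_equiv φ⟩
  invFun op := ⟨_, op.2.of_equiv φ.symm⟩
  left_inv op := by ext; simp
  right_inv op := by ext; simp

/-- There are exactly 404 quandle structures on a 5-element set. -/
theorem card_quandles_order_five :
    Nat.card {op : Fin 5 → Fin 5 → Fin 5 // IsQuandleOp op} = 404 := by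
  have φ : Fin 5 ≃ Pt := Fintype.equivOfCardEq rfl
  rw [Nat.card_congr (quandleOpCongr φ), ← Pt.card_completions_none, ← Nat.card_eq_finsetCard]
  refine Nat.card_congr ((Equiv.piComm fun _ _ => Pt).subtypeEquiv fun op => ?_)
  simp only [Pt.mem_completions, reduceCtorEq, false_imp_iff, implies_true, and_true]
  rfl
end

section
/- The number of quandle structures on a set of 6 elements (equivalently, the number of 6 × 6 standard form quandle matrices) is 6658: there are exactly 6658 binary operations ▷ on {1,…,6} satisfying the three quandle axioms. -/
namespace QuandleCount

/-- Application `k v`, arranged so that kernel reduction evaluates `v` before substituting it. -/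
def force {α : Type} (v : ℕ) (k : ℕ → α) : α := Nat.rec (k 0) (fun n _ => k (Nat.succ n)) v

/-- Application `k l`, arranged so that kernel reduction evaluates the list `l` first. -/
def forceList {α : Type} (l : List ℕ) : (List ℕ → α) → α :=
  List.rec (fun k => k []) (fun a _ ih k => force a fun a => ih fun t => k (a :: t)) l

/-- Five times each point of `Fin 6`: the bit offsets used to address points. -/
def offsets : List ℕ := [0, 5, 10, 15, 20, 25]

/-- The field of five bits of `c` at offset `x`. -/
def cell (c x : ℕ) : ℕ := Nat.land (Nat.shiftRight c x) 31

/-- The code of the column at offset `y` in the packed table `S`, or `0` if it is unknown. -/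
def col (S y : ℕ) : ℕ := Nat.land (Nat.shiftRight S (Nat.add (Nat.mul 6 y) 40)) 1073741823

/-- Enter the code `v` as the column at offset `y`. The summand in the lowest bits is a checksum
which keeps the hashes of different tables apart. -/
def put (S y v : ℕ) : ℕ :=
  Nat.add S (Nat.mul v (Nat.add (Nat.shiftLeft 1 (Nat.add (Nat.mul 6 y) 40)) (Nat.succ y)))

/-- Whether `c ∘ a` and `a ∘ b` agree at `x`. -/
def testAt (a b c x : ℕ) : Bool := Nat.beq (cell c (cell a x)) (cell a (cell b x))

/-- Whether `c ∘ a = a ∘ b`. -/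
def test (a b c : ℕ) : Bool :=
  testAt a b c 0 && (testAt a b c 5 && (testAt a b c 10 && (testAt a b c 15 &&
    (testAt a b c 20 && testAt a b c 25))))

/-- The contribution of the point `x` to `conj a b`. -/
def conjAt (a b x : ℕ) : ℕ := Nat.shiftLeft (cell a (cell b x)) (cell a x)

/-- The code of the conjugate of `b` by `a`. -/
def conj (a b : ℕ) : ℕ :=
  Nat.add (conjAt a b 0) (Nat.add (conjAt a b 5) (Nat.add (conjAt a b 10)
    (Nat.add (conjAt a b 15) (Nat.add (conjAt a b 20) (conjAt a b 25)))))

/-- The code of the identity permutation. -/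
def idCode : ℕ := 860334240

/-- Exploit self-distributivity for the columns `i` and `j`: continue with `k` after filling in
the column which they determine, or give up if that column has another value. -/
def step (S i j : ℕ) (k : ℕ → ℕ) : ℕ :=
  force (col S i) fun a => cond (Nat.beq a 0) (k S) <|
  force (col S j) fun b => cond (Nat.beq b 0) (k S) <|
  force (cell a j) fun z =>
  force (col S z) fun c => cond (Nat.beq c 0) (force (put S z (conj a b)) k) <|
  cond (test a b c) (k S) 0

/-- Perform `step` for the column `y` paired with each of the columns in `l`, in both orders. -/
def propagate (y : ℕ) (l : List ℕ) (k : ℕ → ℕ) : ℕ → ℕ :=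
  List.rec k (fun x _ ih S => step S x y fun S => step S y x ih) l

/-- The sum of `f` over a list. -/
def sumOver (l : List ℕ) (f : ℕ → ℕ) : ℕ := List.rec 0 (fun a _ ih => Nat.add (f a) ih) l

/-- Whether a completely filled table is self-distributive. -/
def isDistributive (S : ℕ) : Bool :=
  offsets.all fun i => force (col S i) fun a => Nat.beq a idCode ||
    offsets.all fun j => test a (col S j) (col S (cell a j))

/-- The weight of a completely filled table: sixty divided by the number of nontrivial columns. -/
def tableWeight (S : ℕ) : ℕ :=
  Nat.div 60 (sumOver offsets fun i => cond (Nat.beq (col S i) idCode) 0 1)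

/-- The total weight of the quandles extending a partial table `S`, where `l` lists the columns
that may be unknown together with their possible values. -/
def search (l : List (ℕ × List ℕ)) : ℕ → ℕ :=
  List.rec (fun S => cond (isDistributive S) (tableWeight S) 0) (fun p _ ih S =>
    cond (Nat.beq (col S p.1) 0)
      (sumOver p.2 fun c => force (put S p.1 c) (propagate p.1 offsets ih)) (ih S)) l

/-- The number whose base 32 digits are `l`. -/
def pack (l : List ℕ) : ℕ := l.foldr (fun d a => d + 32 * a) 0

/-- The codes of all permutations. -/
def perms : List ℕ := (List.permutations' offsets).map pack

/-- The codes of the permutations fixing the point at offset `y`. -/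
def candidates (y : ℕ) : List ℕ := perms.filter fun c => Nat.beq (cell c y) y

/-- Evaluate the candidates for each of the columns `ys` before passing them on to `k`. -/
def withCandidates (ys : List ℕ) : (List (ℕ × List ℕ) → ℕ) → ℕ :=
  List.rec (fun k => k [])
    (fun y _ ih k => forceList (candidates y) fun l => ih fun t => k ((y, l) :: t)) ys

/-- The total weight of the quandles whose first column has code `c`. -/
def searchFrom (c : ℕ) : ℕ :=
  force (put 0 0 c) fun S => withCandidates [5, 10, 15, 20, 25] fun l => search l S

/-- The codes of the conjugates of the permutation with code `r` by permutations fixing `0`. -/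
def conjugates (r : ℕ) : List ℕ := ((candidates 0).map fun t => conj t r).dedup

theorem force_eq {α : Type} (v : ℕ) (k : ℕ → α) : force v k = k v := by
  cases v <;> rfl

theorem forceList_eq {α : Type} (l : List ℕ) (k : List ℕ → α) : forceList l k = k l := by
  induction l generalizing k with
  | nil => rfl
  | cons a l ih =>
    change force a (fun a => forceList l fun t => k (a :: t)) = _
    rw [force_eq, ih]

theorem sumOver_eq (l : List ℕ) (f : ℕ → ℕ) : sumOver l f = (l.map f).sum := by
  induction l with
  | nil => rfl
  | cons a l ih =>
    rw [List.map_cons, List.sum_cons, ← ih]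
    rfl

theorem withCandidates_eq (ys : List ℕ) (k : List (ℕ × List ℕ) → ℕ) :
    withCandidates ys k = k (ys.map fun y => (y, candidates y)) := by
  induction ys generalizing k with
  | nil => rfl
  | cons y ys ih =>
    change forceList (candidates y) (fun l => withCandidates ys fun t => k ((y, l) :: t)) = _
    rw [forceList_eq, ih]
    rfl

theorem cell_eq (c x : ℕ) : cell c x = c / 2 ^ x % 32 := by
  change (c >>> x) &&& (2 ^ 5 - 1) = _
  rw [Nat.and_two_pow_sub_one_eq_mod, Nat.shiftRight_eq_div_pow]

theorem col_eq (S y : ℕ) : col S y = S / 2 ^ (6 * y + 40) % 2 ^ 30 := by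
  change (S >>> (6 * y + 40)) &&& (2 ^ 30 - 1) = _
  rw [Nat.and_two_pow_sub_one_eq_mod, Nat.shiftRight_eq_div_pow]

theorem put_eq (S y v : ℕ) : put S y v = S + v * (2 ^ (6 * y + 40) + (y + 1)) := by
  change S + v * (1 <<< (6 * y + 40) + (y + 1)) = _
  rw [Nat.shiftLeft_eq, one_mul]

theorem ofDigits_div_pow_mod {b : ℕ} {n : ℕ} (f : Fin n → ℕ) (hf : ∀ i, f i < b) (i : Fin n) :
    Nat.ofDigits b (List.ofFn f) / b ^ (i : ℕ) % b = f i := by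
  have hb : 0 < b := (Nat.zero_le _).trans_lt (hf i)
  rw [Nat.ofDigits_div_pow_eq_ofDigits_drop _ hb _ (by simpa [List.mem_ofFn] using hf),
    List.drop_eq_getElem_cons (by simp), Nat.ofDigits_cons, Nat.add_mul_mod_self_left,
    List.getElem_ofFn, Nat.mod_eq_of_lt (hf _)]

/-- The code of a permutation of six points. -/
def code (π : Equiv.Perm (Fin 6)) : ℕ := ∑ x : Fin 6, 5 * (π x : ℕ) * 2 ^ (5 * (x : ℕ))

theorem code_eq_ofDigits (π : Equiv.Perm (Fin 6)) :
    code π = Nat.ofDigits 32 (List.ofFn fun x => 5 * (π x : ℕ)) := by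
  rw [code, Fin.sum_univ_six]
  simp [List.ofFn_succ, Nat.ofDigits_cons]
  ring

theorem cell_code (π : Equiv.Perm (Fin 6)) (x : Fin 6) :
    cell (code π) (5 * x) = 5 * (π x : ℕ) := by
  rw [cell_eq, code_eq_ofDigits, pow_mul]
  exact ofDigits_div_pow_mod (fun x => 5 * (π x : ℕ)) (fun i => by omega) x

theorem code_injective : Function.Injective code := by
  intro π ρ h
  ext x
  have h1 := cell_code π x
  rw [h, cell_code] at h1
  omega

theorem code_lt (π : Equiv.Perm (Fin 6)) : code π < 2 ^ 30 := by
  have h0 := (π 0).isLt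
  have h1 := (π 1).isLt
  have h2 := (π 2).isLt
  have h3 := (π 3).isLt
  have h4 := (π 4).isLt
  have h5 := (π 5).isLt
  rw [code, Fin.sum_univ_six]
  simp
  omega

theorem code_one : code 1 = idCode := by
  simp [code, Fin.sum_univ_six, idCode]

theorem code_ne_zero (π : Equiv.Perm (Fin 6)) : code π ≠ 0 := by
  intro h
  have h0 := cell_code π 0
  have h1 := cell_code π 1
  rw [h, cell_eq, Nat.zero_div, Nat.zero_mod] at h0 h1
  have : π 0 = π 1 := by ext; omega
  exact absurd (π.injective this) (by decide)

theorem conjAt_code (σ π : Equiv.Perm (Fin 6)) (x : Fin 6) :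
    conjAt (code σ) (code π) (5 * x) = 5 * (σ (π x) : ℕ) * 2 ^ (5 * (σ x : ℕ)) := by
  change (cell (code σ) (cell (code π) (5 * x))) <<< (cell (code σ) (5 * x)) = _
  rw [Nat.shiftLeft_eq, cell_code, cell_code, cell_code]

theorem conj_code (σ π : Equiv.Perm (Fin 6)) : conj (code σ) (code π) = code (σ * π * σ⁻¹) := by
  have h : code (σ * π * σ⁻¹) = ∑ x : Fin 6, conjAt (code σ) (code π) (5 * x) := by
    rw [code, ← Equiv.sum_comp σ]
    simp [conjAt_code]
  rw [h, Fin.sum_univ_six]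
  change conjAt _ _ (5 * 0) + (conjAt _ _ (5 * 1) + (conjAt _ _ (5 * 2) + (conjAt _ _ (5 * 3) +
    (conjAt _ _ (5 * 4) + conjAt _ _ (5 * 5))))) = _
  simp only [← add_assoc]
  rfl

theorem testAt_code (σ π ρ : Equiv.Perm (Fin 6)) (x : Fin 6) :
    testAt (code σ) (code π) (code ρ) (5 * x) = true ↔ ρ (σ x) = σ (π x) := by
  rw [testAt, cell_code, cell_code, cell_code, cell_code, Nat.beq_eq, Fin.ext_iff]
  omega

theorem test_code (σ π ρ : Equiv.Perm (Fin 6)) :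
    test (code σ) (code π) (code ρ) = true ↔ ∀ x, ρ (σ x) = σ (π x) := by
  simp only [← testAt_code]
  simp [test, Fin.forall_fin_succ]

/-- The table with the given columns. -/
def table (c : Fin 6 → ℕ) : ℕ := ∑ y : Fin 6, c y * (2 ^ (6 * (5 * (y : ℕ)) + 40) + (5 * y + 1))

theorem table_div (c : Fin 6 → ℕ) (hc : ∀ y, c y < 2 ^ 30) :
    table c / 2 ^ 40 = Nat.ofDigits (2 ^ 30) (List.ofFn c) := by
  have h0 := hc 0
  have h1 := hc 1
  have h2 := hc 2
  have h3 := hc 3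
  have h4 := hc 4
  have h5 := hc 5
  have h : table c = ∑ y : Fin 6, c y * (5 * y + 1) +
      2 ^ 40 * Nat.ofDigits (2 ^ 30) (List.ofFn c) := by
    rw [table, Fin.sum_univ_six, Fin.sum_univ_six]
    simp [List.ofFn_succ, Nat.ofDigits_cons]
    ring
  rw [h, Nat.add_mul_div_left _ _ (by positivity), Nat.div_eq_of_lt, zero_add]
  rw [Fin.sum_univ_six]
  simp
  omega

theorem col_table (c : Fin 6 → ℕ) (hc : ∀ y, c y < 2 ^ 30) (y : Fin 6) :
    col (table c) (5 * y) = c y := by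
  rw [col_eq, add_comm, pow_add, ← Nat.div_div_eq_div_mul, table_div c hc, ← mul_assoc, pow_mul]
  exact ofDigits_div_pow_mod c hc y

theorem put_table (c : Fin 6 → ℕ) (y : Fin 6) (hy : c y = 0) (v : ℕ) :
    put (table c) (5 * y) v = table (Function.update c y v) := by
  rw [put_eq, table, table, ← Finset.add_sum_erase _ _ (Finset.mem_univ y),
    ← Finset.add_sum_erase _ _ (Finset.mem_univ y), hy, Function.update_self, zero_mul, zero_add,
    add_comm]
  congr 1
  refine Finset.sum_congr rfl fun z hz => ?_
  rw [Function.update_of_ne (Finset.ne_of_mem_erase hz)]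

theorem offsets_perm_eq (π : Equiv.Perm (Fin 6)) :
    List.ofFn (fun x => 5 * (π x : ℕ)) ∈ List.permutations' offsets := by
  rw [List.mem_permutations']
  exact Equiv.Perm.ofFn_comp_perm π (fun x : Fin 6 => 5 * (x : ℕ))

theorem pack_ofFn (π : Equiv.Perm (Fin 6)) : pack (List.ofFn fun x => 5 * (π x : ℕ)) = code π := by
  rw [code, Fin.sum_univ_six]
  simp [pack, List.ofFn_succ]
  ring

theorem perms_length : perms.length = 720 := by
  rw [perms, List.length_map, (List.permutations_perm_permutations' _).symm.length_eq,
    List.length_permutations]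
  rfl

theorem perms_toFinset : perms.toFinset = Finset.univ.image code := by
  symm
  refine Finset.eq_of_subset_of_card_le ?_ ?_
  · intro n hn
    obtain ⟨π, -, rfl⟩ := Finset.mem_image.1 hn
    rw [List.mem_toFinset, perms, ← pack_ofFn]
    exact List.mem_map_of_mem (offsets_perm_eq π)
  · rw [Finset.card_image_of_injective _ code_injective, Finset.card_univ, Fintype.card_perm,
      Fintype.card_fin]
    exact (List.toFinset_card_le _).trans perms_length.le

theorem perms_nodup : perms.Nodup := by
  rw [← Multiset.coe_nodup, ← Multiset.toFinset_card_eq_card_iff_nodup]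
  change perms.toFinset.card = perms.length
  rw [perms_toFinset, perms_length, Finset.card_image_of_injective _ code_injective,
    Finset.card_univ, Fintype.card_perm, Fintype.card_fin]
  rfl

theorem candidates_nodup (y : ℕ) : (candidates y).Nodup := perms_nodup.filter _

theorem candidates_toFinset (y : Fin 6) :
    (candidates (5 * y)).toFinset =
      (Finset.univ.filter fun π : Equiv.Perm (Fin 6) => π y = y).image code := by
  ext n
  have h : n ∈ perms ↔ ∃ π, code π = n := by
    rw [← List.mem_toFinset, perms_toFinset]
    simp
  rw [List.mem_toFinset, candidates, List.mem_filter, h]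
  simp only [Finset.mem_image, Finset.mem_filter, Finset.mem_univ, true_and, Nat.beq_eq]
  constructor
  · rintro ⟨⟨π, rfl⟩, hπ⟩
    rw [cell_code] at hπ
    exact ⟨π, by ext; omega, rfl⟩
  · rintro ⟨π, hπ, rfl⟩
    exact ⟨⟨π, rfl⟩, by rw [cell_code, hπ]⟩

/-- Summing over the candidates for a column amounts to summing over permutations. -/
theorem sum_candidates (y : Fin 6) (f : ℕ → ℕ) :
    ((candidates (5 * y)).map f).sum = ∑ π : Equiv.Perm (Fin 6) with π y = y, f (code π) := by
  rw [← List.sum_toFinset f (candidates_nodup _), candidates_toFinset,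
    Finset.sum_image code_injective.injOn]

/-- Sixty divided by the number of points that act nontrivially from the right. -/
def weight (op : Fin 6 → Fin 6 → Fin 6) : ℕ := 60 / ∑ y, if ∀ x, op x y = x then 0 else 1

/-- The quandle operations with the prescribed columns. -/
@[irreducible] noncomputable def extensions (c : Fin 6 → Option (Equiv.Perm (Fin 6))) :
    Finset (Fin 6 → Fin 6 → Fin 6) :=
  (Set.toFinite {op | IsQuandleOp op ∧ ∀ y π, c y = some π → ∀ x, op x y = π x}).toFinset

theorem mem_extensions {c : Fin 6 → Option (Equiv.Perm (Fin 6))} {op : Fin 6 → Fin 6 → Fin 6} :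
    op ∈ extensions c ↔ IsQuandleOp op ∧ ∀ y π, c y = some π → ∀ x, op x y = π x := by
  rw [extensions, Set.Finite.mem_toFinset, Set.mem_ofPred_eq]

theorem mem_extensions_update {c : Fin 6 → Option (Equiv.Perm (Fin 6))} {y : Fin 6}
    (hy : c y = none) (π : Equiv.Perm (Fin 6)) {op : Fin 6 → Fin 6 → Fin 6} :
    op ∈ extensions (Function.update c y (some π)) ↔
      op ∈ extensions c ∧ ∀ x, op x y = π x := by
  rw [mem_extensions, mem_extensions]
  constructor
  · rintro ⟨h, h'⟩
    refine ⟨⟨h, fun z ρ hz => ?_⟩, h' y π (Function.update_self ..)⟩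
    have hzy : z ≠ y := by
      rintro rfl
      simp [hy] at hz
    exact h' z ρ (by rw [Function.update_of_ne hzy, hz])
  · rintro ⟨⟨h, h'⟩, hπ⟩
    refine ⟨h, fun z ρ hz => ?_⟩
    by_cases hzy : z = y
    · subst hzy
      rw [Function.update_self, Option.some_inj] at hz
      rwa [← hz]
    · rw [Function.update_of_ne hzy] at hz
      exact h' z ρ hz

/-- The total weight of the quandle operations with the prescribed columns. -/
noncomputable def totalWeight (c : Fin 6 → Option (Equiv.Perm (Fin 6))) : ℕ :=
  ∑ op ∈ extensions c, weight op

/-- The columns of a quandle operation are permutations. -/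
theorem IsQuandleOp.exists_perm {op : Fin 6 → Fin 6 → Fin 6} (h : IsQuandleOp op) (y : Fin 6) :
    ∃ π : Equiv.Perm (Fin 6), π y = y ∧ ∀ x, op x y = π x := by
  have hb : Function.Bijective fun x => op x y := by
    refine Function.bijective_iff_existsUnique _ |>.2 fun x => ?_
    simpa only [eq_comm] using h.2.1 x y
  exact ⟨Equiv.ofBijective _ hb, h.1 y, fun _ => rfl⟩

/-- The total weight as a sum over the possible values of an unknown column. -/
theorem totalWeight_eq_sum {c : Fin 6 → Option (Equiv.Perm (Fin 6))} {y : Fin 6}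
    (hy : c y = none) :
    totalWeight c = ∑ π : Equiv.Perm (Fin 6) with π y = y,
      totalWeight (Function.update c y (some π)) := by
  classical
  have h : extensions c = ({π | π y = y} : Finset (Equiv.Perm (Fin 6))).biUnion
      fun π => extensions (Function.update c y (some π)) := by
    ext op
    simp only [Finset.mem_biUnion, Finset.mem_filter, Finset.mem_univ, true_and,
      mem_extensions_update hy]
    constructor
    · intro hop
      obtain ⟨π, h1, h2⟩ := IsQuandleOp.exists_perm (mem_extensions.1 hop).1 y
      exact ⟨π, h1, hop, h2⟩
    · rintro ⟨π, -, hop, -⟩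
      exact hop
  rw [totalWeight, h, Finset.sum_biUnion]
  · rfl
  · intro π _ ρ _ hne
    refine Finset.disjoint_left.2 fun op h1 h2 => hne ?_
    ext x
    rw [← ((mem_extensions_update hy π).1 h1).2 x, ((mem_extensions_update hy ρ).1 h2).2 x]

/-- A partial table is valid if its columns fix their own index. -/
def Valid (c : Fin 6 → Option (Equiv.Perm (Fin 6))) : Prop := ∀ y π, c y = some π → π y = y

theorem Valid.update {c : Fin 6 → Option (Equiv.Perm (Fin 6))} (hc : Valid c) {y : Fin 6}
    {π : Equiv.Perm (Fin 6)} (hπ : π y = y) : Valid (Function.update c y (some π)) := by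
  intro z ρ hz
  by_cases hzy : z = y
  · subst hzy
    rw [Function.update_self, Option.some_inj] at hz
    rwa [← hz]
  · rw [Function.update_of_ne hzy] at hz
    exact hc z ρ hz

/-- The packed form of a partial table. -/
def encode (c : Fin 6 → Option (Equiv.Perm (Fin 6))) : ℕ := table fun y => (c y).elim 0 code

theorem col_encode (c : Fin 6 → Option (Equiv.Perm (Fin 6))) (y : Fin 6) :
    col (encode c) (5 * y) = (c y).elim 0 code := by
  have h (z : Fin 6) : (c z).elim 0 code < 2 ^ 30 := by
    rcases c z with _ | π
    · rw [Option.elim_none]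
      norm_num
    · rw [Option.elim_some]
      exact code_lt π
  rw [encode, col_table (fun z => (c z).elim 0 code) h y]

theorem put_encode {c : Fin 6 → Option (Equiv.Perm (Fin 6))} {y : Fin 6} (hy : c y = none)
    (π : Equiv.Perm (Fin 6)) :
    put (encode c) (5 * y) (code π) = encode (Function.update c y (some π)) := by
  have h : (fun z => (c z).elim 0 code) y = 0 := by
    simp only [hy, Option.elim_none]
  rw [encode, put_table (fun z => (c z).elim 0 code) y h, encode]
  refine congrArg table (funext fun z => ?_)
  by_cases hzy : z = y
  · subst hzy
    rw [Function.update_self, Function.update_self, Option.elim_some]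
  · rw [Function.update_of_ne hzy, Function.update_of_ne hzy]

/-- The function `k` computes total weights of partial tables whose columns are all known,
except possibly those in `s`. -/
def Computes (s : Set (Fin 6)) (k : ℕ → ℕ) : Prop :=
  ∀ c, Valid c → (∀ y, c y = none → y ∈ s) → k (encode c) = totalWeight c

/-- Two known columns determine a third one. -/
theorem extension_conj {c : Fin 6 → Option (Equiv.Perm (Fin 6))} {i j : Fin 6}
    {σ π : Equiv.Perm (Fin 6)} (hi : c i = some σ) (hj : c j = some π)
    {op : Fin 6 → Fin 6 → Fin 6} (hop : op ∈ extensions c) (x : Fin 6) :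
    op (σ x) (σ j) = σ (π x) := by
  obtain ⟨h, h'⟩ := mem_extensions.1 hop
  have := h.2.2 x j i
  rw [h' i σ hi, h' i σ hi, h' i σ hi, h' j π hj] at this
  exact this.symm

theorem beq_code_zero (π : Equiv.Perm (Fin 6)) : Nat.beq (code π) 0 = false := by
  rw [← Bool.not_eq_true, Nat.beq_eq]
  exact code_ne_zero π

theorem step_eq (S i j : ℕ) (k : ℕ → ℕ) : step S i j k =
    cond (Nat.beq (col S i) 0) (k S) (cond (Nat.beq (col S j) 0) (k S)
      (cond (Nat.beq (col S (cell (col S i) j)) 0)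
        (k (put S (cell (col S i) j) (conj (col S i) (col S j))))
        (cond (test (col S i) (col S j) (col S (cell (col S i) j))) (k S) 0))) := by
  rw [step, force_eq, force_eq, force_eq, force_eq, force_eq]

theorem Computes.step {s : Set (Fin 6)} {k : ℕ → ℕ} (hk : Computes s k) (i j : Fin 6) :
    Computes s fun S => step S (5 * i) (5 * j) k := by
  intro c hc hs
  beta_reduce
  rw [step_eq, col_encode, col_encode]
  rcases hi : c i with _ | σ
  · rw [Option.elim_none, Nat.beq_refl, cond_true]
    exact hk c hc hs
  rw [Option.elim_some, beq_code_zero, cond_false]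
  rcases hj : c j with _ | π
  · rw [Option.elim_none, Nat.beq_refl, cond_true]
    exact hk c hc hs
  rw [Option.elim_some, beq_code_zero, cond_false, cell_code, col_encode, conj_code]
  rcases hz : c (σ j) with _ | ρ
  · have hfix : (σ * π * σ⁻¹) (σ j) = σ j := by simp [hc j π hj]
    rw [Option.elim_none, Nat.beq_refl, cond_true, put_encode hz, hk _ (hc.update hfix)]
    · refine Finset.sum_congr ?_ fun _ _ => rfl
      ext op
      rw [mem_extensions_update hz]
      refine and_iff_left_of_imp fun hop x => ?_
      simpa using extension_conj hi hj hop (σ⁻¹ x)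
    · intro y hy
      refine hs y ?_
      by_cases hyz : y = σ j
      · rwa [hyz]
      · rwa [Function.update_of_ne hyz] at hy
  rw [Option.elim_some, beq_code_zero, cond_false]
  rcases ht : test (code σ) (code π) (code ρ) with _ | _
  · rw [← Bool.not_eq_true, test_code] at ht
    rw [cond_false, totalWeight, Finset.sum_eq_zero]
    intro op hop
    refine absurd (fun x => ?_) ht
    rw [← extension_conj hi hj hop, (mem_extensions.1 hop).2 _ ρ hz]
  · exact hk c hc hs

theorem offsets_eq : offsets = (List.finRange 6).map fun x : Fin 6 => 5 * (x : ℕ) := by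
  decide

theorem Computes.propagate {s : Set (Fin 6)} {k : ℕ → ℕ} (hk : Computes s k) (y : Fin 6) :
    Computes s (propagate (5 * y) offsets k) := by
  rw [offsets_eq]
  induction List.finRange 6 with
  | nil => exact hk
  | cons x l ih => exact (ih.step y x).step x y

theorem all_offsets (p : ℕ → Bool) : offsets.all p = true ↔ ∀ x : Fin 6, p (5 * x) = true := by
  simp [offsets_eq]

theorem beq_code_idCode (π : Equiv.Perm (Fin 6)) :
    Nat.beq (code π) idCode = true ↔ ∀ x, π x = x := by
  rw [Nat.beq_eq, ← code_one, code_injective.eq_iff, Equiv.ext_iff]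
  rfl

theorem isDistributive_encode {c : Fin 6 → Option (Equiv.Perm (Fin 6))}
    {π : Fin 6 → Equiv.Perm (Fin 6)} (hc : ∀ y, c y = some (π y)) :
    isDistributive (encode c) = true ↔ ∀ i j x, π (π i j) (π i x) = π i (π j x) := by
  rw [isDistributive, all_offsets]
  refine forall_congr' fun i => ?_
  rw [force_eq, Bool.or_eq_true, all_offsets, col_encode, hc, Option.elim_some, beq_code_idCode]
  have h (j : Fin 6) : test (code (π i)) (col (encode c) (5 * j))
      (col (encode c) (cell (code (π i)) (5 * j))) = true ↔
      ∀ x, π (π i j) (π i x) = π i (π j x) := by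
    rw [cell_code, col_encode, col_encode, hc, hc, Option.elim_some, Option.elim_some, test_code]
  rw [forall_congr' h]
  exact or_iff_right_of_imp fun hi j x => by rw [hi, hi, hi]

theorem tableWeight_eq (S : ℕ) :
    tableWeight S = 60 / ∑ y : Fin 6, cond (Nat.beq (col S (5 * y)) idCode) 0 1 := by
  have h (n : ℕ) : Nat.div 60 n = 60 / n := rfl
  rw [tableWeight, h, sumOver_eq, offsets_eq, List.map_map, ← List.ofFn_eq_map, List.sum_ofFn]
  simp only [Function.comp_apply]

theorem tableWeight_encode {c : Fin 6 → Option (Equiv.Perm (Fin 6))}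
    {π : Fin 6 → Equiv.Perm (Fin 6)} (hc : ∀ y, c y = some (π y)) :
    tableWeight (encode c) = weight fun x y => π y x := by
  have h (y : Fin 6) : cond (Nat.beq (col (encode c) (5 * y)) idCode) 0 1 =
      if ∀ x, π y x = x then 0 else 1 := by
    rw [col_encode, hc, Option.elim_some, Bool.cond_eq_ite]
    exact if_congr (beq_code_idCode _) rfl rfl
  rw [tableWeight_eq, weight, ← Finset.sum_congr rfl fun y _ => h y]

theorem computes_leaf :
    Computes ∅ fun S => cond (isDistributive S) (tableWeight S) 0 := by
  intro c hv hs
  have hc (y : Fin 6) : ∃ π, c y = some π :=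
    Option.ne_none_iff_exists'.1 fun h => hs y h
  choose π hc using hc
  have hmem (op) (hop : op ∈ extensions c) : op = fun x y => π y x := by
    ext x y
    rw [(mem_extensions.1 hop).2 y (π y) (hc y)]
  change cond (isDistributive (encode c)) (tableWeight (encode c)) 0 = totalWeight c
  by_cases hd : isDistributive (encode c) = true
  · rw [hd, cond_true, tableWeight_encode hc]
    rw [isDistributive_encode hc] at hd
    have : extensions c = {fun x y => π y x} := by
      refine Finset.eq_singleton_iff_unique_mem.2 ⟨mem_extensions.2 ⟨⟨?_, ?_, ?_⟩, ?_⟩, hmem⟩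
      · exact fun y => hv y (π y) (hc y)
      · exact fun x y => ⟨(π y).symm x, by simp, fun z hz => by simp [hz]⟩
      · exact fun x y z => (hd z y x).symm
      · intro y ρ hy x
        rw [hc, Option.some_inj] at hy
        rw [hy]
    rw [totalWeight, this, Finset.sum_singleton]
  · rw [Bool.eq_false_of_not_eq_true hd, cond_false, totalWeight, Finset.sum_eq_zero]
    intro op hop
    have hq := (mem_extensions.1 hop).1
    rw [hmem op hop] at hq
    rw [isDistributive_encode hc] at hd
    exact absurd (fun i j x => (hq.2.2 x j i).symm) hd

theorem search_cons (y : ℕ) (m : List ℕ) (l : List (ℕ × List ℕ)) (S : ℕ) :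
    search ((y, m) :: l) S = cond (Nat.beq (col S y) 0)
      (m.map fun v => propagate y offsets (search l) (put S y v)).sum (search l S) := by
  have h (v : ℕ) : propagate y offsets (search l) (put S y v) =
      force (put S y v) (propagate y offsets (search l)) := (force_eq _ _).symm
  simp only [h, ← sumOver_eq]
  rfl

theorem computes_search (l : List (Fin 6)) :
    Computes {y | y ∈ l} (search (l.map fun y : Fin 6 => (5 * (y : ℕ), candidates (5 * y)))) := by
  induction l with
  | nil => exact fun c hc hs => computes_leaf c hc fun y hy => absurd (hs y hy) (by simp)
  | cons y l ih =>
    intro c hc hs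
    rw [List.map_cons, search_cons, col_encode]
    rcases hy : c y with _ | π
    · rw [Option.elim_none, Nat.beq_refl, cond_true, sum_candidates, totalWeight_eq_sum hy]
      refine Finset.sum_congr rfl fun π hπ => ?_
      rw [put_encode hy]
      refine ih.propagate y _ (hc.update (Finset.mem_filter.1 hπ).2) fun z hz => ?_
      have hzy : z ≠ y := by
        rintro rfl
        simp at hz
      rw [Function.update_of_ne hzy] at hz
      exact (List.mem_cons.1 (hs z hz)).resolve_left hzy
    · rw [Option.elim_some, beq_code_zero, cond_false]
      refine ih c hc fun z hz => (List.mem_cons.1 (hs z hz)).resolve_left ?_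
      rintro rfl
      simp [hy] at hz

/-- The partial table in which only the first column is known. -/
def firstColumn (π : Equiv.Perm (Fin 6)) : Fin 6 → Option (Equiv.Perm (Fin 6)) :=
  Function.update (fun _ => none) 0 (some π)

theorem searchFrom_code {π : Equiv.Perm (Fin 6)} (hπ : π 0 = 0) :
    searchFrom (code π) = totalWeight (firstColumn π) := by
  have h0 : encode (fun _ => none) = 0 := by simp [encode, table]
  have h1 : put 0 0 (code π) = encode (firstColumn π) := by
    rw [firstColumn, ← put_encode rfl, h0]
    rfl
  have hv : Valid (firstColumn π) := Valid.update (by simp [Valid]) hπ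
  have hs : ∀ y, firstColumn π y = none → y ∈ ([1, 2, 3, 4, 5] : List (Fin 6)) := by
    intro y hy
    fin_cases y <;> simp [firstColumn] at hy ⊢
  have hl : ([5, 10, 15, 20, 25] : List ℕ) =
      ([1, 2, 3, 4, 5] : List (Fin 6)).map fun y => 5 * (y : ℕ) := by decide
  rw [searchFrom, force_eq, withCandidates_eq, h1, hl, List.map_map]
  exact computes_search _ _ hv hs

theorem mem_extensions_none {op : Fin 6 → Fin 6 → Fin 6} :
    op ∈ extensions (fun _ => none) ↔ IsQuandleOp op := by
  rw [mem_extensions]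
  exact and_iff_left fun y π h => absurd h (Option.some_ne_none π).symm

theorem mem_extensions_firstColumn {π : Equiv.Perm (Fin 6)} {op : Fin 6 → Fin 6 → Fin 6} :
    op ∈ extensions (firstColumn π) ↔ IsQuandleOp op ∧ ∀ x, op x 0 = π x := by
  rw [firstColumn, mem_extensions_update rfl, mem_extensions_none]

/-- Transport of a binary operation along a permutation. -/
def relabel (τ : Equiv.Perm (Fin 6)) : Equiv.Perm (Fin 6 → Fin 6 → Fin 6) :=
  Equiv.arrowCongr τ (Equiv.arrowCongr τ τ)

theorem relabel_apply (τ : Equiv.Perm (Fin 6)) (op : Fin 6 → Fin 6 → Fin 6) (x y : Fin 6) :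
    relabel τ op (τ x) (τ y) = τ (op x y) := by
  simp [relabel]

theorem IsQuandleOp.relabel {op : Fin 6 → Fin 6 → Fin 6} (h : IsQuandleOp op)
    (τ : Equiv.Perm (Fin 6)) : IsQuandleOp (relabel τ op) := by
  refine ⟨fun x => ?_, fun x y => ?_, fun x y z => ?_⟩
  · obtain ⟨x, rfl⟩ := τ.surjective x
    rw [relabel_apply, h.1]
  · obtain ⟨x, rfl⟩ := τ.surjective x
    obtain ⟨y, rfl⟩ := τ.surjective y
    obtain ⟨z, hz, hu⟩ := h.2.1 x y
    refine ⟨τ z, by beta_reduce; rw [relabel_apply, ← hz], fun w hw => ?_⟩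
    obtain ⟨w, rfl⟩ := τ.surjective w
    rw [relabel_apply, τ.apply_eq_iff_eq] at hw
    rw [hu w hw]
  · obtain ⟨x, rfl⟩ := τ.surjective x
    obtain ⟨y, rfl⟩ := τ.surjective y
    obtain ⟨z, rfl⟩ := τ.surjective z
    rw [relabel_apply, relabel_apply, relabel_apply, relabel_apply, relabel_apply, h.2.2]

theorem isQuandleOp_relabel (τ : Equiv.Perm (Fin 6)) {op : Fin 6 → Fin 6 → Fin 6} :
    IsQuandleOp (relabel τ op) ↔ IsQuandleOp op := by
  refine ⟨fun h => ?_, fun h => IsQuandleOp.relabel h τ⟩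
  have : relabel τ⁻¹ (relabel τ op) = op := (relabel τ).symm_apply_apply op
  rw [← this]
  exact IsQuandleOp.relabel h τ⁻¹

theorem relabel_trivial_iff (τ : Equiv.Perm (Fin 6)) (op : Fin 6 → Fin 6 → Fin 6) (y : Fin 6) :
    (∀ x, relabel τ op x (τ y) = x) ↔ ∀ x, op x y = x := by
  rw [← τ.forall_congr_right]
  exact forall_congr' fun x => by rw [relabel_apply, τ.apply_eq_iff_eq]

theorem weight_relabel (τ : Equiv.Perm (Fin 6)) (op : Fin 6 → Fin 6 → Fin 6) :
    weight (relabel τ op) = weight op := by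
  rw [weight, weight, ← Equiv.sum_comp τ]
  exact congrArg _ (Finset.sum_congr rfl fun y _ => if_congr (relabel_trivial_iff τ op y) rfl rfl)

theorem totalWeight_firstColumn_conj {σ : Equiv.Perm (Fin 6)} (hσ : σ 0 = 0)
    (π : Equiv.Perm (Fin 6)) :
    totalWeight (firstColumn (σ * π * σ⁻¹)) = totalWeight (firstColumn π) := by
  symm
  refine Finset.sum_equiv (relabel σ) (fun op => ?_) fun op _ => (weight_relabel σ op).symm
  rw [mem_extensions_firstColumn, mem_extensions_firstColumn, isQuandleOp_relabel]
  refine and_congr_right fun _ => ?_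
  rw [← σ.forall_congr_right (q := fun x => relabel σ op x 0 = _)]
  refine forall_congr' fun x => ?_
  have h := relabel_apply σ op x 0
  rw [hσ] at h
  rw [h]
  simp

/-- Codes of representatives of the nontrivial conjugacy classes of permutations fixing `0`. -/
def reps : List ℕ := [697804960, 530196640, 697646240, 362429600, 530191680, 194657600]

theorem reps_subset_check :
    (forceList (candidates 0) fun l => reps.all fun r => l.any fun c => Nat.beq r c) = true := by
  decide +kernel

theorem candidates_check :
    (forceList (candidates 0) fun l => forceList (idCode :: reps.flatMap conjugates) fun l' =>
      l.isPerm l') = true := by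
  decide +kernel

theorem candidates_perm : (candidates 0).Perm (idCode :: reps.flatMap conjugates) := by
  have h := candidates_check
  rwa [forceList_eq, forceList_eq, List.isPerm_iff] at h

theorem exists_code_of_mem_candidates {n : ℕ} (hn : n ∈ candidates 0) :
    ∃ π : Equiv.Perm (Fin 6), π 0 = 0 ∧ code π = n := by
  have h : n ∈ (candidates (5 * ((0 : Fin 6) : ℕ))).toFinset := List.mem_toFinset.2 hn
  rw [candidates_toFinset] at h
  simpa using h

theorem exists_code_of_mem_reps {r : ℕ} (hr : r ∈ reps) :
    ∃ π : Equiv.Perm (Fin 6), π 0 = 0 ∧ code π = r := by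
  have h := reps_subset_check
  rw [forceList_eq, List.all_eq_true] at h
  obtain ⟨c, hc, hrc⟩ := List.any_eq_true.1 (h r hr)
  rw [Nat.eq_of_beq_eq_true hrc]
  exact exists_code_of_mem_candidates hc

theorem searchFrom_conjugates {r : ℕ} (hr : r ∈ reps) {n : ℕ} (hn : n ∈ conjugates r) :
    searchFrom n = searchFrom r := by
  obtain ⟨π, hπ, rfl⟩ := exists_code_of_mem_reps hr
  rw [conjugates, List.mem_dedup, List.mem_map] at hn
  obtain ⟨t, ht, rfl⟩ := hn
  obtain ⟨σ, hσ, rfl⟩ := exists_code_of_mem_candidates ht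
  have hfix : (σ * π * σ⁻¹) 0 = 0 := by
    have h : σ⁻¹ 0 = 0 := by rw [Equiv.Perm.inv_eq_iff_eq, hσ]
    rw [Equiv.Perm.mul_apply, Equiv.Perm.mul_apply, h, hπ, hσ]
  rw [conj_code, searchFrom_code hfix, searchFrom_code hπ, totalWeight_firstColumn_conj hσ]

theorem sum_conjugates {r : ℕ} (hr : r ∈ reps) {k v : ℕ}
    (hk : Nat.beq (forceList (conjugates r) List.length) k = true)
    (hv : Nat.beq (searchFrom r) v = true) :
    ((conjugates r).map searchFrom).sum = k * v := by
  rw [forceList_eq, Nat.beq_eq] at hk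
  rw [Nat.beq_eq] at hv
  rw [List.map_congr_left fun n hn => searchFrom_conjugates hr hn, List.map_const',
    List.sum_replicate, hk, hv, smul_eq_mul]

theorem sum_conjugates_transposition : ((conjugates 697804960).map searchFrom).sum = 10 * 2919 :=
  sum_conjugates (by decide) (by decide +kernel) (by decide +kernel)

theorem sum_conjugates_threeCycle : ((conjugates 530196640).map searchFrom).sum = 20 * 598 :=
  sum_conjugates (by decide) (by decide +kernel) (by decide +kernel)

theorem sum_conjugates_doubleTransposition :
    ((conjugates 697646240).map searchFrom).sum = 15 * 964 :=
  sum_conjugates (by decide) (by decide +kernel) (by decide +kernel)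

theorem sum_conjugates_fourCycle : ((conjugates 362429600).map searchFrom).sum = 30 * 204 :=
  sum_conjugates (by decide) (by decide +kernel) (by decide +kernel)

theorem sum_conjugates_threeCycle_mul_transposition :
    ((conjugates 530191680).map searchFrom).sum = 20 * 170 :=
  sum_conjugates (by decide) (by decide +kernel) (by decide +kernel)

theorem sum_conjugates_fiveCycle : ((conjugates 194657600).map searchFrom).sum = 24 * 60 :=
  sum_conjugates (by decide) (by decide +kernel) (by decide +kernel)

theorem sum_candidates_searchFrom :
    ((candidates 0).map searchFrom).sum = searchFrom idCode + 66570 := by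
  rw [(candidates_perm.map searchFrom).sum_eq, List.map_cons, List.sum_cons, reps]
  simp only [List.flatMap_cons, List.flatMap_nil, List.map_append, List.sum_append, List.map_nil,
    List.sum_nil, sum_conjugates_transposition, sum_conjugates_threeCycle,
    sum_conjugates_doubleTransposition, sum_conjugates_fourCycle,
    sum_conjugates_threeCycle_mul_transposition, sum_conjugates_fiveCycle]
  omega

theorem totalWeight_none :
    totalWeight (fun _ => none) = totalWeight (firstColumn 1) + 66570 := by
  rw [← searchFrom_code rfl, code_one, ← sum_candidates_searchFrom, totalWeight_eq_sum (y := 0) rfl]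
  refine Eq.trans (Finset.sum_congr rfl fun π hπ => ?_) (sum_candidates 0 searchFrom).symm
  exact (searchFrom_code (Finset.mem_filter.1 hπ).2).symm

/-- The total weight of the quandle operations for which `0` acts nontrivially. -/
theorem sum_weight_nontrivial :
    ∑ op ∈ extensions fun _ => none, (if ∀ x, op x 0 = x then 0 else weight op) = 66570 := by
  have h : ∑ op ∈ extensions fun _ => none, (if ∀ x, op x 0 = x then weight op else 0) =
      totalWeight (firstColumn 1) := by
    rw [← Finset.sum_filter, totalWeight]
    refine Finset.sum_congr ?_ fun _ _ => rfl
    ext op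
    rw [Finset.mem_filter, mem_extensions_none, mem_extensions_firstColumn]
    rfl
  refine Nat.add_left_cancel (n := totalWeight (firstColumn 1)) ?_
  rw [← totalWeight_none, ← h, ← Finset.sum_add_distrib, totalWeight]
  refine Finset.sum_congr rfl fun op _ => ?_
  split_ifs <;> simp

/-- By symmetry, the point `0` in `sum_weight_nontrivial` can be replaced by any other one. -/
theorem sum_weight_nontrivial_at (y : Fin 6) :
    ∑ op ∈ extensions fun _ => none, (if ∀ x, op x y = x then 0 else weight op) = 66570 := by
  rw [← sum_weight_nontrivial]
  refine Finset.sum_equiv (relabel (Equiv.swap 0 y)) (fun op => ?_) fun op _ => ?_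
  · rw [mem_extensions_none, mem_extensions_none, isQuandleOp_relabel]
  · have h := relabel_trivial_iff (Equiv.swap 0 y) op y
    rw [Equiv.swap_apply_right] at h
    rw [weight_relabel]
    exact (if_congr h rfl rfl).symm

theorem mul_weight (op : Fin 6 → Fin 6 → Fin 6) :
    ∑ y, (if ∀ x, op x y = x then 0 else weight op) = if ∀ y x, op x y = x then 0 else 60 := by
  have h1 : ∑ y, (if ∀ x, op x y = x then 0 else weight op) =
      (∑ y, if ∀ x, op x y = x then 0 else 1) * weight op := by
    rw [Finset.sum_mul]
    exact Finset.sum_congr rfl fun y _ => by split_ifs <;> simp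
  rw [h1, weight]
  split_ifs with h
  · simp [h]
  · obtain ⟨y, hy⟩ := not_forall.1 h
    have hpos : 1 ≤ ∑ y, if ∀ x, op x y = x then 0 else 1 := by
      refine le_trans ?_ (Finset.single_le_sum (fun _ _ => Nat.zero_le _) (Finset.mem_univ y))
      rw [if_neg hy]
    have hle : (∑ y, if ∀ x, op x y = x then 0 else 1) ≤ 6 := by
      refine (Finset.sum_le_card_nsmul _ _ 1 fun y _ => ?_).trans (by simp)
      split_ifs <;> simp
    generalize (∑ y, if ∀ x, op x y = x then 0 else 1) = k at hpos hle ⊢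
    interval_cases k <;> rfl

theorem card_extensions_none : (extensions fun _ => none).card = 6658 := by
  classical
  have htriv : (fun x _ => x) ∈ extensions fun _ => none := by
    rw [mem_extensions_none]
    exact ⟨fun x => rfl, fun x y => ⟨x, rfl, fun z hz => hz.symm⟩, fun x y z => rfl⟩
  have h : ∑ op ∈ extensions fun _ => none, (if ∀ y x, op x y = x then 0 else 60) = 6 * 66570 := by
    rw [← Finset.sum_congr rfl fun op _ => mul_weight op, Finset.sum_comm,
      Finset.sum_congr rfl fun y _ => sum_weight_nontrivial_at y]
    simp
  rw [← Finset.add_sum_erase _ _ htriv, if_pos fun _ _ => rfl, zero_add,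
    Finset.sum_congr rfl fun op hop => if_neg fun hy =>
      Finset.ne_of_mem_erase hop (funext fun x => funext fun y => hy y x),
    Finset.sum_const, smul_eq_mul] at h
  rw [← Finset.card_erase_add_one htriv]
  omega

end QuandleCount

/-- There are exactly 6658 quandle structures on a 6-element set. -/
theorem card_quandles_order_six :
    Nat.card {op : Fin 6 → Fin 6 → Fin 6 // IsQuandleOp op} = 6658 := by
  rw [← QuandleCount.card_extensions_none]
  exact Nat.subtype_card _ fun _ => QuandleCount.mem_extensions_none
end
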